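/- arXiv:1301.4823 — 3 statements merged into one kernel-verified Lean document; each statement's English description precedes it below -/
import Mathlib

section
/- Let σ_{12}, σ_{13}, σ_{23} be real numbers satisfying the four Bell inequalities: 1 + σ_{12} + σ_{13} + σ_{23} ≥ 0, 1 − σ_{12} + σ_{13} − σ_{23} ≥ 0, 1 + σ_{12} − σ_{13} − σ_{23} ≥ 0, and 1 − σ_{12} − σ_{13} + σ_{23} ≥ 0. Then there exists a probability measure μ on {-1,1}^3 whose coordinate random variables ξ_1, ξ_2, ξ_3 satisfy μ(ξ_i = 1) = μ(ξ_i = -1) = 1/2 for i = 1,2,3 and E[ξ_i ξ_j] = σ_{ij} for all 1 ≤ i < j ≤ 3. -/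
open MeasureTheory

/-- The symmetric measure giving each of the two points `ω` and `-ω` mass `a`. -/
noncomputable def antipodalDirac (a : ℝ) (ω : Fin 3 → ℤˣ) : Measure (Fin 3 → ℤˣ) :=
  ENNReal.ofReal a • (Measure.dirac ω + Measure.dirac (-ω))

instance Int.units_measurableSingletonClass : MeasurableSingletonClass ℤˣ where
  measurableSet_singleton u :=
    ⟨{(u : ℤ)}, measurableSet_singleton _, by ext v; simp [Units.ext_iff]⟩

instance isFiniteMeasure_antipodalDirac (a : ℝ) (ω : Fin 3 → ℤˣ) :
    IsFiniteMeasure (antipodalDirac a ω) :=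
  Measure.smul_finite _ ENNReal.ofReal_ne_top

theorem antipodalDirac_univ (a : ℝ) (ω : Fin 3 → ℤˣ) :
    antipodalDirac a ω Set.univ = ENNReal.ofReal a * 2 := by
  simp [antipodalDirac, mul_two]

theorem antipodalDirac_coord_eq (a : ℝ) (ω : Fin 3 → ℤˣ) (i : Fin 3) (u : ℤˣ) :
    antipodalDirac a ω {η | η i = u} = ENNReal.ofReal a := by
  have hne : (1 : ℤˣ) ≠ -1 := by decide
  rcases Int.units_eq_one_or (ω i) with h | h <;>
    rcases Int.units_eq_one_or u with rfl | rfl <;>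
      simp [antipodalDirac, Set.indicator, h, hne, hne.symm]

theorem integral_antipodalDirac {a : ℝ} (ha : 0 ≤ a) (ω : Fin 3 → ℤˣ) (i j : Fin 3) :
    ∫ η, (((η i : ℤ) : ℝ) * ((η j : ℤ) : ℝ)) ∂(antipodalDirac a ω) =
      2 * a * (((ω i : ℤ) : ℝ) * ((ω j : ℤ) : ℝ)) := by
  rw [antipodalDirac, integral_smul_measure,
    integral_add_measure Integrable.of_finite Integrable.of_finite, integral_dirac, integral_dirac,
    ENNReal.toReal_ofReal ha]
  simp
  ring

/-- If `σ12, σ13, σ23` satisfy the four Bell inequalities, then there is a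
probability measure on `{-1,1}^3` (modeled as `Fin 3 → ℤˣ`) whose coordinate spin
variables have uniform marginals and the prescribed pairwise correlations. -/
theorem exists_spin_measure_of_bell_inequalities
    (σ12 σ13 σ23 : ℝ)
    (h1 : 0 ≤ 1 + σ12 + σ13 + σ23)
    (h2 : 0 ≤ 1 - σ12 + σ13 - σ23)
    (h3 : 0 ≤ 1 + σ12 - σ13 - σ23)
    (h4 : 0 ≤ 1 - σ12 - σ13 + σ23) :
    ∃ μ : Measure (Fin 3 → ℤˣ), IsProbabilityMeasure μ ∧
      (∀ i : Fin 3, μ {ω | ω i = 1} = 1/2 ∧ μ {ω | ω i = -1} = 1/2) ∧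
      (∫ ω, (((ω 0 : ℤ) : ℝ) * ((ω 1 : ℤ) : ℝ)) ∂μ) = σ12 ∧
      (∫ ω, (((ω 0 : ℤ) : ℝ) * ((ω 2 : ℤ) : ℝ)) ∂μ) = σ13 ∧
      (∫ ω, (((ω 1 : ℤ) : ℝ) * ((ω 2 : ℤ) : ℝ)) ∂μ) = σ23 := by
  obtain ⟨a, ha⟩ : ∃ a, a = (1 + σ12 + σ13 + σ23) / 8 := ⟨_, rfl⟩
  obtain ⟨b, hb⟩ : ∃ b, b = (1 - σ12 + σ13 - σ23) / 8 := ⟨_, rfl⟩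
  obtain ⟨c, hc⟩ : ∃ c, c = (1 + σ12 - σ13 - σ23) / 8 := ⟨_, rfl⟩
  obtain ⟨d, hd⟩ : ∃ d, d = (1 - σ12 - σ13 + σ23) / 8 := ⟨_, rfl⟩
  have ha0 : 0 ≤ a := by linarith
  have hb0 : 0 ≤ b := by linarith
  have hc0 : 0 ≤ c := by linarith
  have hd0 : 0 ≤ d := by linarith
  have hsum : ENNReal.ofReal a + ENNReal.ofReal b + ENNReal.ofReal c + ENNReal.ofReal d
      = 1 / 2 := by
    rw [← ENNReal.ofReal_add ha0 hb0, ← ENNReal.ofReal_add (by positivity) hc0,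
      ← ENNReal.ofReal_add (by positivity) hd0,
      show a + b + c + d = 1 / 2 by linarith, ENNReal.ofReal_div_of_pos two_pos]
    simp
  let μ := antipodalDirac a ![1, 1, 1] + antipodalDirac b ![1, -1, 1] +
    antipodalDirac c ![1, 1, -1] + antipodalDirac d ![-1, 1, 1]
  have hint (i j : Fin 3) {s : ℝ}
      (hs : 2 * a * (((![1, 1, 1] i : ℤˣ) : ℤ) * ((![1, 1, 1] j : ℤˣ) : ℤ)) +
        2 * b * (((![1, -1, 1] i : ℤˣ) : ℤ) * ((![1, -1, 1] j : ℤˣ) : ℤ)) +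
        2 * c * (((![1, 1, -1] i : ℤˣ) : ℤ) * ((![1, 1, -1] j : ℤˣ) : ℤ)) +
        2 * d * (((![-1, 1, 1] i : ℤˣ) : ℤ) * ((![-1, 1, 1] j : ℤˣ) : ℤ)) = s) :
      ∫ ω, (((ω i : ℤ) : ℝ) * ((ω j : ℤ) : ℝ)) ∂μ = s := by
    rw [integral_add_measure Integrable.of_finite Integrable.of_finite,
      integral_add_measure Integrable.of_finite Integrable.of_finite,
      integral_add_measure Integrable.of_finite Integrable.of_finite,
      integral_antipodalDirac ha0, integral_antipodalDirac hb0,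
      integral_antipodalDirac hc0, integral_antipodalDirac hd0, hs]
  have hcoord (i : Fin 3) (u : ℤˣ) : μ {ω | ω i = u} = 1 / 2 := by
    simp only [μ, Measure.add_apply, antipodalDirac_coord_eq, hsum]
  refine ⟨μ, ⟨?_⟩, fun i => ⟨hcoord i 1, hcoord i (-1)⟩, ?_, ?_, ?_⟩
  · simp only [μ, Measure.add_apply, antipodalDirac_univ, ← add_mul, hsum]
    exact ENNReal.div_mul_cancel two_ne_zero ENNReal.ofNat_ne_top
  all_goals
    apply hint
    simp
    linarith
end

section
/- Let Σ be a real symmetric 3×3 matrix with all diagonal entries equal to 1, with off-diagonal entries σ_{12}, σ_{13}, σ_{23}. Then Σ is the correlation matrix of three spin random variables (i.e., there exists a probability measure μ on {-1,1}^3 whose coordinates ξ_i satisfy μ(ξ_i = 1) = μ(ξ_i = -1) = 1/2 and E[ξ_i ξ_j] = σ_{ij}) if and only if the four Bell inequalities hold: 1 + σ_{12} + σ_{13} + σ_{23} ≥ 0, 1 − σ_{12} + σ_{13} − σ_{23} ≥ 0, 1 + σ_{12} − σ_{13} − σ_{23} ≥ 0, and 1 − σ_{12} − σ_{13} + σ_{23}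 ≥ 0. -/
open MeasureTheory

theorem sum_fin_three_pi_units_int {M : Type*} [AddCommMonoid M] (f : (Fin 3 → ℤˣ) → M) :
    ∑ ω, f ω = ∑ a : ℤˣ, ∑ b : ℤˣ, ∑ c : ℤˣ, f ![a, b, c] := by
  let e : ℤˣ × ℤˣ × ℤˣ ≃ (Fin 3 → ℤˣ) :=
    { toFun := fun p => ![p.1, p.2.1, p.2.2]
      invFun := fun ω => (ω 0, ω 1, ω 2)
      left_inv := fun _ => rfl
      right_inv := fun ω => by ext i; fin_cases i <;> rfl }
  rw [← e.sum_comp, Fintype.sum_prod_type]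
  simp_rw [Fintype.sum_prod_type]
  rfl

/-- The measure on a finite type with real point masses `w`. -/
noncomputable def weightedDirac {α : Type*} [Fintype α] [MeasurableSpace α] (w : α → ℝ) :
    Measure α :=
  ∑ x, ENNReal.ofReal (w x) • Measure.dirac x

section weightedDirac

variable {α : Type*} [Fintype α] [MeasurableSpace α] [MeasurableSingletonClass α]

theorem weightedDirac_apply {w : α → ℝ} (hw : ∀ x, 0 ≤ w x) (p : α → Prop) [DecidablePred p] :
    weightedDirac w {x | p x} = ENNReal.ofReal (∑ x, if p x then w x else 0) := by
  rw [ENNReal.ofReal_sum_of_nonneg fun x _ => by split_ifs <;> simp [hw]]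
  simp only [weightedDirac, Measure.finsetSum_apply, Measure.smul_apply, smul_eq_mul,
    Measure.dirac_apply]
  refine Finset.sum_congr rfl fun x _ => ?_
  by_cases h : p x <;> simp [h]

theorem integral_weightedDirac {w : α → ℝ} (hw : ∀ x, 0 ≤ w x) (f : α → ℝ) :
    ∫ x, f x ∂(weightedDirac w) = ∑ x, w x * f x := by
  rw [weightedDirac, integral_finsetSum_measure]
  · simp [integral_smul_measure, ENNReal.toReal_ofReal, hw]
  · exact fun x _ => (integrable_dirac (by simp)).smul_measure ENNReal.ofReal_ne_top

end weightedDirac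

/-- A real symmetric 3×3 matrix `Σ` with unit diagonal is the correlation
matrix of three spin random variables (i.e. `Σ j k = E[ξ_j ξ_k]` for the coordinates of
some probability measure on `{-1,1}^3` with uniform marginals) if and only if its
off-diagonal entries `σ12 = Σ 0 1`, `σ13 = Σ 0 2`, `σ23 = Σ 1 2` satisfy the four Bell
inequalities. -/
theorem spin_correlation_matrix_iff_bell_inequalities
    (S : Matrix (Fin 3) (Fin 3) ℝ) (hsymm : S.IsSymm) (hdiag : ∀ i, S i i = 1) :
    (∃ μ : Measure (Fin 3 → ℤˣ), IsProbabilityMeasure μ ∧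
        (∀ i : Fin 3, μ {ω | ω i = 1} = 1/2 ∧ μ {ω | ω i = -1} = 1/2) ∧
        (∀ j k : Fin 3, S j k = ∫ ω, (((ω j : ℤ) : ℝ) * ((ω k : ℤ) : ℝ)) ∂μ)) ↔
      (0 ≤ 1 + S 0 1 + S 0 2 + S 1 2 ∧
       0 ≤ 1 - S 0 1 + S 0 2 - S 1 2 ∧
       0 ≤ 1 + S 0 1 - S 0 2 - S 1 2 ∧
       0 ≤ 1 - S 0 1 - S 0 2 + S 1 2) := by
  have : MeasurableSingletonClass ℤˣ :=
    ⟨fun a => ⟨{(a : ℤ)}, measurableSet_singleton _, by ext b; simp [Units.ext_iff]⟩⟩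
  constructor
  · rintro ⟨μ, hμ, -, hS⟩
    have key (a b c : ℝ) (h : ∀ ω : Fin 3 → ℤˣ,
        0 ≤ 1 + a * (((ω 0 : ℤ) : ℝ) * ((ω 1 : ℤ) : ℝ)) + b * (((ω 0 : ℤ) : ℝ) * ((ω 2 : ℤ) : ℝ))
          + c * (((ω 1 : ℤ) : ℝ) * ((ω 2 : ℤ) : ℝ))) :
        0 ≤ 1 + a * S 0 1 + b * S 0 2 + c * S 1 2 := by
      have := integral_nonneg (μ := μ) (Pi.le_def.2 h)
      rw [integral_add .of_finite .of_finite, integral_add .of_finite .of_finite,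
        integral_add .of_finite .of_finite, integral_const_mul, integral_const_mul,
        integral_const_mul, ← hS, ← hS, ← hS] at this
      simpa using this
    have pointwise (a b c : ℝ) (h₁ : 0 ≤ 1 + a + b + c) (h₂ : 0 ≤ 1 - a + b - c)
        (h₃ : 0 ≤ 1 + a - b - c) (h₄ : 0 ≤ 1 - a - b + c) :
        0 ≤ 1 + a * S 0 1 + b * S 0 2 + c * S 1 2 := by
      refine key a b c fun ω => ?_
      rcases Int.units_eq_one_or (ω 0) with h0 | h0 <;>
      rcases Int.units_eq_one_or (ω 1) with h1 | h1 <;>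
      rcases Int.units_eq_one_or (ω 2) with h2 | h2 <;>
      simp only [h0, h1, h2, Units.val_one, Units.val_neg, Int.cast_one, Int.cast_neg] <;>
      linarith
    refine ⟨?_, ?_, ?_, ?_⟩
    · linarith [pointwise 1 1 1 (by norm_num) (by norm_num) (by norm_num) (by norm_num)]
    · linarith [pointwise (-1) 1 (-1) (by norm_num) (by norm_num) (by norm_num) (by norm_num)]
    · linarith [pointwise 1 (-1) (-1) (by norm_num) (by norm_num) (by norm_num) (by norm_num)]
    · linarith [pointwise (-1) (-1) 1 (by norm_num) (by norm_num) (by norm_num) (by norm_num)]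
  · rintro ⟨h₁, h₂, h₃, h₄⟩
    let w (ω : Fin 3 → ℤˣ) : ℝ :=
      (1 + ((ω 0 : ℤ) : ℝ) * ((ω 1 : ℤ) : ℝ) * S 0 1 + ((ω 0 : ℤ) : ℝ) * ((ω 2 : ℤ) : ℝ) * S 0 2
        + ((ω 1 : ℤ) : ℝ) * ((ω 2 : ℤ) : ℝ) * S 1 2) / 8
    have hw (ω) : 0 ≤ w ω := by
      rcases Int.units_eq_one_or (ω 0) with h0 | h0 <;>
      rcases Int.units_eq_one_or (ω 1) with h1 | h1 <;>
      rcases Int.units_eq_one_or (ω 2) with h2 | h2 <;>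
      simp only [w, h0, h1, h2, Units.val_one, Units.val_neg, Int.cast_one, Int.cast_neg] <;>
      linarith
    have half : ENNReal.ofReal (1 / 2) = 1 / 2 := by
      rw [ENNReal.ofReal_div_of_pos two_pos]; simp
    have neg_ne : (-1 : ℤˣ) ≠ 1 := by decide
    have ne_neg : (1 : ℤˣ) ≠ -1 := by decide
    refine ⟨weightedDirac w, ⟨?_⟩, fun i => ⟨?_, ?_⟩, fun j k => ?_⟩
    · rw [← Set.ofPred_true, weightedDirac_apply hw, ← ENNReal.ofReal_one]
      congr 1
      simp [sum_fin_three_pi_units_int, w]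
      ring
    · rw [weightedDirac_apply hw, ← half]
      congr 1
      fin_cases i <;> simp [sum_fin_three_pi_units_int, w, neg_ne] <;> ring
    · rw [weightedDirac_apply hw, ← half]
      congr 1
      fin_cases i <;> simp [sum_fin_three_pi_units_int, w, ne_neg] <;> ring
    · rw [integral_weightedDirac hw]
      have h10 := hsymm.apply 0 1
      have h20 := hsymm.apply 0 2
      have h21 := hsymm.apply 1 2
      fin_cases j <;> fin_cases k <;>
        simp [sum_fin_three_pi_units_int, w, hdiag, h10, h20, h21] <;> ring
end

section
/- Let v_1 = (1,1,1)^T, v_2 = (1,-1,1)^T, v_3 = (1,1,-1)^T, v_4 = (-1,1,1)^T and set Σ_i = v_i v_i^T for i = 1,…,4. A real symmetric 3×3 matrix Σ with unit diagonal is the correlation matrix of three spin random variables if and only if Σ is a convex combination of Σ_1, Σ_2, Σ_3, Σ_4, i.e., Σ = λ_1 Σ_1 + λ_2 Σ_2 + λ_3 Σ_3 + λ_4 Σ_4 with λ_i ≥ 0 and λ_1 + λ_2 + λ_3 + λ_4 = 1. -/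
open MeasureTheory

/-- The four sign vectors `v_1 = (1,1,1)`, `v_2 = (1,-1,1)`, `v_3 = (1,1,-1)`,
`v_4 = (-1,1,1)`. -/
def bellVec : Fin 4 → (Fin 3 → ℝ) :=
  ![![1, 1, 1], ![1, -1, 1], ![1, 1, -1], ![-1, 1, 1]]

/-- The four extreme matrices `Σ_i = v_i v_iᵀ`. -/
def bellMat (i : Fin 4) : Matrix (Fin 3) (Fin 3) ℝ :=
  Matrix.vecMulVec (bellVec i) (bellVec i)

instance : MeasurableSingletonClass ℤˣ where
  measurableSet_singleton u := ⟨{(u : ℤ)}, .singleton _, by ext; simp [Units.ext_iff]⟩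

/-- The uniform law on the two antipodal spin configurations `u` and `-u`. -/
noncomputable def antipodalMeasure (u : Fin 3 → ℤˣ) : Measure (Fin 3 → ℤˣ) :=
  (1 / 2 : ENNReal) • (Measure.dirac u + Measure.dirac (-u))

instance (u : Fin 3 → ℤˣ) : IsProbabilityMeasure (antipodalMeasure u) := by
  constructor
  simp only [antipodalMeasure, Measure.smul_apply, Measure.add_apply, measure_univ, smul_eq_mul,
    one_div, one_add_one_eq_two]
  exact ENNReal.inv_mul_cancel two_ne_zero ENNReal.ofNat_ne_top

lemma antipodalMeasure_marginal (u : Fin 3 → ℤˣ) (i : Fin 3) (e : ℤˣ) :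
    antipodalMeasure u {ω | ω i = e} = 1 / 2 := by
  have hne : (-1 : ℤˣ) ≠ 1 := by decide
  rcases Int.units_eq_one_or (u i) with h | h <;> rcases Int.units_eq_one_or e with he | he <;>
    simp [antipodalMeasure, h, he, hne, hne.symm]

lemma integral_antipodalMeasure (u : Fin 3 → ℤˣ) (f : (Fin 3 → ℤˣ) → ℝ) :
    ∫ ω, f ω ∂antipodalMeasure u = (f u + f (-u)) / 2 := by
  rw [antipodalMeasure, integral_smul_measure,
    integral_add_measure Integrable.of_finite Integrable.of_finite, integral_dirac, integral_dirac]
  simp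
  ring

/-- The sign vectors `bellVec` as spin configurations. -/
def bellSpin : Fin 4 → (Fin 3 → ℤˣ) :=
  ![![1, 1, 1], ![1, -1, 1], ![1, 1, -1], ![-1, 1, 1]]

lemma coe_bellSpin (i : Fin 4) (j : Fin 3) : ((bellSpin i j : ℤ) : ℝ) = bellVec i j := by
  fin_cases i <;> fin_cases j <;> simp [bellSpin, bellVec]

/-- Bell's inequalities for the pair correlations of three spins: for signs `a`, `b` the function
`1 + a ω₀ω₁ + b ω₀ω₂ + ab ω₁ω₂` is nonnegative, hence so is its expectation. -/
lemma bell_inequality (μ : Measure (Fin 3 → ℤˣ)) [IsProbabilityMeasure μ] (a b : ℤˣ) :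
    0 ≤ 1 + ((a : ℤ) : ℝ) * ∫ ω, (((ω 0 : ℤ) : ℝ) * ((ω 1 : ℤ) : ℝ)) ∂μ
      + ((b : ℤ) : ℝ) * ∫ ω, (((ω 0 : ℤ) : ℝ) * ((ω 2 : ℤ) : ℝ)) ∂μ
      + ((a : ℤ) : ℝ) * ((b : ℤ) : ℝ) * ∫ ω, (((ω 1 : ℤ) : ℝ) * ((ω 2 : ℤ) : ℝ)) ∂μ := by
  have hpos : 0 ≤ ∫ ω, (1 + ((a : ℤ) : ℝ) * (((ω 0 : ℤ) : ℝ) * ((ω 1 : ℤ) : ℝ))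
      + ((b : ℤ) : ℝ) * (((ω 0 : ℤ) : ℝ) * ((ω 2 : ℤ) : ℝ))
      + ((a : ℤ) : ℝ) * ((b : ℤ) : ℝ) * (((ω 1 : ℤ) : ℝ) * ((ω 2 : ℤ) : ℝ))) ∂μ := by
    refine integral_nonneg fun ω => ?_
    rcases Int.units_eq_one_or a with ha | ha <;> rcases Int.units_eq_one_or b with hb | hb <;>
    rcases Int.units_eq_one_or (ω 0) with h0 | h0 <;>
    rcases Int.units_eq_one_or (ω 1) with h1 | h1 <;>
    rcases Int.units_eq_one_or (ω 2) with h2 | h2 <;>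
      norm_num [ha, hb, h0, h1, h2]
  rwa [integral_add Integrable.of_finite Integrable.of_finite,
    integral_add Integrable.of_finite Integrable.of_finite,
    integral_add Integrable.of_finite Integrable.of_finite,
    integral_const_mul, integral_const_mul, integral_const_mul, integral_const,
    probReal_univ, one_smul] at hpos

/-- A real symmetric 3×3 matrix with unit diagonal is the correlation matrix
of three spin random variables if and only if it is a convex combination of
`Σ_1, Σ_2, Σ_3, Σ_4`. -/
theorem spin_correlation_matrix_iff_convex_combination
    (S : Matrix (Fin 3) (Fin 3) ℝ) (hsymm : S.IsSymm) (hdiag : ∀ i, S i i = 1) :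
    (∃ μ : Measure (Fin 3 → ℤˣ), IsProbabilityMeasure μ ∧
        (∀ i : Fin 3, μ {ω | ω i = 1} = 1/2 ∧ μ {ω | ω i = -1} = 1/2) ∧
        (∀ j k : Fin 3, S j k = ∫ ω, (((ω j : ℤ) : ℝ) * ((ω k : ℤ) : ℝ)) ∂μ)) ↔
      (∃ lam : Fin 4 → ℝ, (∀ i, 0 ≤ lam i) ∧ (∑ i, lam i = 1) ∧
        S = ∑ i, lam i • bellMat i) := by
  constructor
  · rintro ⟨μ, hμ, -, hS⟩
    have h₁ := bell_inequality μ 1 1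
    have h₂ := bell_inequality μ (-1) 1
    have h₃ := bell_inequality μ 1 (-1)
    have h₄ := bell_inequality μ (-1) (-1)
    simp only [← hS] at h₁ h₂ h₃ h₄
    push_cast at h₁ h₂ h₃ h₄
    refine ⟨![(1 + S 0 1 + S 0 2 + S 1 2) / 4, (1 - S 0 1 + S 0 2 - S 1 2) / 4,
      (1 + S 0 1 - S 0 2 - S 1 2) / 4, (1 - S 0 1 - S 0 2 + S 1 2) / 4], ?_, ?_, ?_⟩
    · intro i
      fin_cases i <;> simp <;> linarith
    · simp [Fin.sum_univ_four]
      ring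
    · ext j k
      fin_cases j <;> fin_cases k <;>
        simp [Fin.sum_univ_four, bellMat, bellVec, hdiag,
          hsymm.apply 0 1, hsymm.apply 0 2, hsymm.apply 1 2] <;> ring
  · rintro ⟨lam, hpos, hsum, rfl⟩
    have hsum' : ∑ i, ENNReal.ofReal (lam i) = 1 := by
      rw [← ENNReal.ofReal_sum_of_nonneg fun i _ => hpos i, hsum, ENNReal.ofReal_one]
    refine ⟨∑ i, ENNReal.ofReal (lam i) • antipodalMeasure (bellSpin i), ⟨?_⟩, ?_, ?_⟩
    · simp [Measure.finsetSum_apply, hsum']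
    · intro i
      constructor <;>
        simp only [Measure.finsetSum_apply, Measure.smul_apply, antipodalMeasure_marginal,
          smul_eq_mul, ← Finset.sum_mul, hsum', one_mul]
    · intro j k
      rw [integral_finsetSum_measure fun i _ =>
        Integrable.smul_measure Integrable.of_finite ENNReal.ofReal_ne_top]
      simp only [integral_smul_measure, integral_antipodalMeasure, Matrix.sum_apply,
        Matrix.smul_apply, bellMat, Matrix.vecMulVec_apply, smul_eq_mul, Pi.neg_apply,
        Units.val_neg, Int.cast_neg, neg_mul_neg, coe_bellSpin, add_self_div_two,
        ENNReal.toReal_ofReal (hpos _)]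
end
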